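/- For every natural number n, the following identity of polynomials in q holds: Σ_{M ∈ M_{2n}} q^{cro(M)} = Σ over Dyck paths P of length 2n of Π over down steps of P of [h]_q, where h is the height at which the down step starts and [h]_q = 1+q+…+q^{h-1}. -/

import Mathlib

open Finset

inductive Step : Type
  | U | L | D
deriving DecidableEq

instance : Fintype Step :=
  ⟨{Step.U, Step.L, Step.D}, fun x => by cases x <;> simp⟩

/-- The vertical displacement of a step: up = +1, level = 0, down = -1. -/
def Step.val : Step → ℤ
  | .U => 1
  | .L => 0
  | .D => -1

/-- The partial sum of the step values of the first `i` steps;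
this is the height at which step `i` starts. -/
def hsum {n : ℕ} (P : Fin n → Step) (i : ℕ) : ℤ :=
  ∑ j ∈ Finset.univ.filter (fun j : Fin n => (j : ℕ) < i), (P j).val

/-- A Motzkin path: all partial sums nonnegative and total sum 0. -/
abbrev IsMotzkin {n : ℕ} (P : Fin n → Step) : Prop :=
  (∀ i : Fin (n+1), 0 ≤ hsum P (i : ℕ)) ∧ hsum P n = 0

/-- A Motzkin prefix of final height `k`: all partial sums nonnegative, total sum `k`. -/
abbrev IsMPrefix {n : ℕ} (P : Fin n → Step) (k : ℕ) : Prop :=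
  (∀ i : Fin (n+1), 0 ≤ hsum P (i : ℕ)) ∧ hsum P n = (k : ℤ)

/-- `[h]_q = 1 + q + ... + q^(h-1)`. -/
def geo {R : Type*} [CommSemiring R] (q : R) (h : ℤ) : R :=
  ∑ i ∈ Finset.range h.toNat, q ^ i

/-- The Gaussian (q-)binomial coefficient, via the q-Pascal recurrence. -/
def qbinom {R : Type*} [CommSemiring R] (q : R) : ℕ → ℕ → R
  | _, 0 => 1
  | 0, _+1 => 0
  | n+1, k+1 => qbinom q n k + q ^ (k+1) * qbinom q n (k+1)

/-- The binomial coefficient with integer lower argument, zero on negative arguments. -/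
def ch (m : ℕ) (j : ℤ) : ℤ := if 0 ≤ j then m.choose j.toNat else 0

/-- A matching of `{1, …, m}`, encoded as a fixed-point-free involution:
its blocks are the pairs `{i, σ i}`. -/
abbrev IsMatching {m : ℕ} (σ : Equiv.Perm (Fin m)) : Prop :=
  (∀ i, σ (σ i) = i) ∧ ∀ i, σ i ≠ i

/-- The number of crossings of a matching: pairs of blocks `{i,j}`, `{k,l}`
with `i < k < j < l`, counted as pairs `(i,k)` with `i < k < σ i < σ k`. -/
def cro {m : ℕ} (σ : Equiv.Perm (Fin m)) : ℕ :=
  (Finset.univ.filter (fun p : Fin m × Fin m =>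
    p.1 < p.2 ∧ p.2 < σ p.1 ∧ σ p.1 < σ p.2)).card


open Polynomial in
/-- Weighted count of path suffixes with `d` steps from height `h`. -/
noncomputable def WW : ℕ → ℕ → Polynomial ℤ
  | 0, 0 => 1
  | 0, _+1 => 0
  | d+1, h => WW d (h+1) + geo (X : Polynomial ℤ) (h:ℤ) * WW d (h-1)

lemma hsum_zero' {n : ℕ} (P : Fin n → Step) : hsum P 0 = 0 := by simp [hsum]

lemma hsum_cons {n : ℕ} (s : Step) (P : Fin n → Step) (i : ℕ) :
    hsum (Fin.cons s P : Fin (n+1) → Step) (i+1) = s.val + hsum P i := by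
  unfold hsum
  rw [Finset.sum_filter, Fin.sum_univ_succ, Finset.sum_filter]
  simp

open Polynomial in
lemma path_side (d : ℕ) : ∀ h : ℕ,
    ∑ P ∈ Finset.univ.filter (fun P : Fin d → Step =>
      ((∀ i : Fin (d+1), 0 ≤ (h:ℤ) + hsum P (i : ℕ)) ∧ (h:ℤ) + hsum P d = 0) ∧ ∀ i, P i ≠ Step.L),
      ∏ i : Fin d, (if P i = Step.D then geo (X : Polynomial ℤ) ((h:ℤ) + hsum P (i : ℕ)) else 1)
    = WW d h := by
  induction d with
  | zero =>
    intro h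
    rw [Finset.sum_filter]
    cases h with
    | zero => simp [WW, hsum]
    | succ h =>
      have : ¬ ((h:ℤ) + 1 = 0) := by omega
      simp [WW, hsum, this]
  | succ d ih =>
    intro h
    rw [Finset.sum_filter, ← (Fin.consEquiv (fun _ => Step)).sum_comp, Fintype.sum_prod_type]
    have hu : (Finset.univ : Finset Step) = {Step.U, Step.L, Step.D} := rfl
    rw [hu, Finset.sum_insert (by decide), Finset.sum_insert (by decide), Finset.sum_singleton]
    simp only [Fin.consEquiv, Equiv.coe_fn_mk, Fin.prod_univ_succ, Fin.forall_fin_succ (n := d+1),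
      Fin.forall_fin_succ (n := d), Fin.cons_zero, Fin.cons_succ, Fin.val_succ, hsum_cons,
      Fin.val_zero, hsum_zero', Step.val]
    rw [WW, ← ih, ← ih, Finset.sum_filter, Finset.sum_filter]
    simp only [ne_eq, not_true_eq_false, false_and, and_false, if_false, Finset.sum_const_zero,
      zero_add]
    congr 1
    · refine Finset.sum_congr rfl fun P _ => ?_
      simp [add_assoc, Fin.forall_fin_succ, hsum_zero']
    · rw [Finset.mul_sum]
      refine Finset.sum_congr rfl fun P _ => ?_
      rcases h with _ | h
      · simp [geo]
      · have : (0:ℤ) ≤ h + 1 := by omega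
        simp [add_assoc, this, Fin.forall_fin_succ, hsum_zero']

lemma geo_sum {α R : Type*} [LinearOrder α] [CommSemiring R] (q : R) (O : Finset α) :
    ∑ j ∈ O, q ^ (O.filter (fun i => j < i)).card = geo q (O.card : ℤ) := by
  induction O using Finset.induction_on_min with
  | empty => simp [geo]
  | insert a s ha ih =>
    have hn : a ∉ s := fun h => lt_irrefl _ (ha a h)
    rw [Finset.sum_insert hn, Finset.card_insert_of_notMem hn]
    have e1 : (insert a s).filter (fun i => a < i) = s := by
      ext x; simp only [Finset.mem_filter, Finset.mem_insert]
      constructor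
      · rintro ⟨rfl | h, h'⟩
        · exact absurd h' (lt_irrefl _)
        · exact h
      · intro h; exact ⟨Or.inr h, ha x h⟩
    have e2 : ∑ j ∈ s, q ^ ((insert a s).filter (fun i => j < i)).card
        = ∑ j ∈ s, q ^ (s.filter (fun i => j < i)).card := by
      refine Finset.sum_congr rfl fun j hj => ?_
      rw [Finset.filter_insert, if_neg (not_lt.mpr (ha j hj).le)]
    rw [e1, e2, ih]
    simp only [geo, Int.toNat_natCast]
    rw [Finset.sum_range_succ, add_comm]

/-- Partial matchings with open points `O` below `k`, and all points at least `k` active. -/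
def Good {N : ℕ} (k : ℕ) (O : Finset (Fin N)) (σ : Equiv.Perm (Fin N)) : Prop :=
  (∀ i, σ (σ i) = i) ∧ (∀ i, σ i ≠ i ↔ (i ∈ O ∨ k ≤ i.val)) ∧ ∀ i ∈ O, k ≤ (σ i).val

lemma good_open {N : ℕ} (k : Fin N) (O : Finset (Fin N)) (hO : ∀ i ∈ O, i < k)
    (σ : Equiv.Perm (Fin N)) :
    (Good k O σ ∧ σ k ∉ O) ↔ Good (k+1) (insert k O) σ := by
  unfold Good
  have key : ∀ i : Fin N, (i ∈ insert k O ∨ k.val + 1 ≤ i.val) ↔ (i ∈ O ∨ k.val ≤ i.val) := by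
    intro i
    have : k.val ≤ i.val ↔ (i = k ∨ k.val + 1 ≤ i.val) := by rw [Fin.ext_iff]; omega
    rw [Finset.mem_insert, this]; tauto
  simp only [key]
  constructor
  · rintro ⟨⟨h1, h2, h3⟩, h4⟩
    refine ⟨h1, h2, ?_⟩
    intro i hi
    have hk : σ k ≠ k := (h2 k).2 (Or.inr le_rfl)
    rcases Finset.mem_insert.1 hi with rfl | hi
    · have : σ (σ i) ≠ σ i := by rw [h1]; exact hk.symm
      have := (h2 (σ i)).1 this
      have h5 : (σ i).val ≠ i.val := fun h => hk (Fin.ext h)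
      rcases this with h | h
      · exact absurd h h4
      · omega
    · have h5 : (σ i).val ≠ k.val := by
        intro h
        have : σ i = k := Fin.ext h
        rw [← this, h1] at h4
        exact h4 hi
      have := h3 i hi
      omega
  · rintro ⟨h1, h2, h3⟩
    refine ⟨⟨h1, h2, fun i hi => ?_⟩, fun h => ?_⟩
    · have := h3 i (Finset.mem_insert_of_mem hi); omega
    · have := h3 k (Finset.mem_insert_self _ _)
      have h5 := hO _ h
      rw [Fin.lt_def] at h5
      omega

lemma good_close {N : ℕ} (k : Fin N) (O : Finset (Fin N)) (hO : ∀ i ∈ O, i < k)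
    (j : Fin N) (hj : j ∈ O) (σ : Equiv.Perm (Fin N)) :
    (Good k O σ ∧ σ k = j) ↔ Good (k+1) (O.erase j) (σ * Equiv.swap j k) := by
  have hjk := hO j hj
  have e : ∀ i, i ≠ j → i ≠ k → (σ * Equiv.swap j k) i = σ i := fun i a b => by
    simp [Equiv.swap_apply_of_ne_of_ne a b]
  have ej : (σ * Equiv.swap j k) j = σ k := by simp
  have ek : (σ * Equiv.swap j k) k = σ j := by simp
  generalize σ * Equiv.swap j k = τ at *
  unfold Good
  have key : ∀ i : Fin N, (i ∈ O.erase j ∨ k.val + 1 ≤ i.val) ↔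
      (i ≠ j ∧ i ≠ k ∧ (i ∈ O ∨ k.val ≤ i.val)) := by
    intro i
    have := hO i
    grind
  simp only [key]
  constructor
  · rintro ⟨⟨h1, h2, h3⟩, hk⟩
    have hσj : σ j = k := by rw [← hk, h1]
    refine ⟨fun i => ?_, fun i => ?_, fun i hi => ?_⟩
    · grind
    · grind
    · grind
  · rintro ⟨h1, h2, h3⟩
    have hk : σ k = j := by
      by_contra hc
      have := (h2 j).1 (by rwa [ej])
      exact this.1 rfl
    have hσj : σ j = k := by
      by_contra hc
      have := (h2 k).1 (by rwa [ek])
      exact this.2.1 rfl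
    refine ⟨⟨fun i => ?_, fun i => ?_, fun i hi => ?_⟩, hk⟩
    · grind
    · grind
    · grind

lemma cro_close {N : ℕ} (k : Fin N) (O : Finset (Fin N)) (hO : ∀ i ∈ O, i < k)
    (j : Fin N) (hj : j ∈ O) (σ : Equiv.Perm (Fin N)) (h : Good k O σ) (hk : σ k = j) :
    cro σ = (O.filter (fun i => j < i)).card + cro (σ * Equiv.swap j k) := by
  have hjk := hO j hj
  obtain ⟨h1, h2, h3⟩ := h
  have hσj : σ j = k := by rw [← hk, h1]
  have e : ∀ i, i ≠ j → i ≠ k → (σ * Equiv.swap j k) i = σ i := fun i a b => by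
    simp [Equiv.swap_apply_of_ne_of_ne a b]
  have ej : (σ * Equiv.swap j k) j = j := by simp [hk]
  have ek : (σ * Equiv.swap j k) k = k := by simp [hσj]
  generalize σ * Equiv.swap j k = τ at *
  unfold cro
  rw [← Finset.card_map (Function.Embedding.sectR j (Fin N)), ← Finset.card_union_of_disjoint]
  · congr 1
    ext ⟨a, b⟩
    simp only [Finset.mem_filter, Finset.mem_univ, true_and, Finset.mem_union, Finset.mem_map,
      Function.Embedding.sectR_apply, Prod.mk.injEq]
    have a2 := h2 a
    have b2 := h2 b
    have a3 := h3 a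
    have b3 := h3 b
    have b1 := h1 b
    have ea := e a
    have eb := e b
    have oa := hO a
    have ob := hO b
    grind
  · rw [Finset.disjoint_left]
    rintro ⟨a, b⟩ h h'
    simp only [Finset.mem_filter, Finset.mem_univ, true_and, Finset.mem_map,
      Function.Embedding.sectR_apply, Prod.mk.injEq] at h h'
    obtain ⟨x, _, rfl, rfl⟩ := h
    rw [ej] at h'
    exact absurd (h'.1.trans h'.2.1) (lt_irrefl _)

open Polynomial Classical in
lemma match_side {N : ℕ} (d : ℕ) : ∀ (k : ℕ), k + d = N → ∀ O : Finset (Fin N),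
    (∀ i ∈ O, i.val < k) →
    ∑ σ ∈ Finset.univ.filter (fun σ : Equiv.Perm (Fin N) => Good k O σ),
      (X : Polynomial ℤ) ^ cro σ = WW d O.card := by
  induction d with
  | zero =>
    intro k hk O hO
    rcases O.eq_empty_or_nonempty with rfl | ⟨x, hx⟩
    · have : Finset.univ.filter (fun σ : Equiv.Perm (Fin N) => Good k ∅ σ) = {1} := by
        ext σ
        simp only [Finset.mem_filter, Finset.mem_univ, true_and, Finset.mem_singleton]
        unfold Good
        constructor
        · rintro ⟨_, h, _⟩
          ext i
          by_contra hc
          have := (h i).1 (fun h' => hc (by rw [h']; rfl))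
          have := i.2
          simp at *
          omega
        · rintro rfl
          refine ⟨fun i => rfl, fun i => ?_, by simp⟩
          have := i.2
          simp
          omega
      rw [this, Finset.sum_singleton]
      have : cro (1 : Equiv.Perm (Fin N)) = 0 := by
        unfold cro
        rw [Finset.card_eq_zero, Finset.filter_eq_empty_iff]
        rintro p _ ⟨h1, h2, _⟩
        exact absurd (h1.trans h2) (lt_irrefl _)
      rw [this]; simp [WW]
    · have : Finset.univ.filter (fun σ : Equiv.Perm (Fin N) => Good k O σ) = ∅ := by
        rw [Finset.filter_eq_empty_iff]
        rintro σ _ ⟨_, _, h⟩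
        have := h x hx
        have := (σ x).2
        omega
      rw [this, Finset.sum_empty]
      obtain ⟨c, hc⟩ : ∃ c, O.card = c + 1 :=
        ⟨O.card - 1, by have := Finset.card_pos.2 ⟨x, hx⟩; omega⟩
      rw [hc, WW]
  | succ d ih =>
    intro k hk O hO
    obtain ⟨K, rfl⟩ : ∃ K : Fin N, K.val = k := ⟨⟨k, by omega⟩, rfl⟩
    have hO' : ∀ i ∈ O, i < K := hO
    rw [WW, ← geo_sum, Finset.sum_mul, ← Finset.sum_filter_add_sum_filter_not _ (fun σ => σ K ∉ O)]
    congr 1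
    · have hK : K ∉ O := fun h => lt_irrefl _ (hO' K h)
      rw [← Finset.card_insert_of_notMem hK, ← ih (K+1) (by omega), Finset.filter_filter]
      · simp only [good_open K O hO']
      · intro i hi
        rcases Finset.mem_insert.1 hi with rfl | hi
        · omega
        · have := hO i hi; omega
    · rw [← Finset.sum_fiberwise_of_maps_to (g := fun σ => σ K) (t := O)]
      · refine Finset.sum_congr rfl fun j hj => ?_
        rw [← Finset.card_erase_of_mem hj, ← ih (K+1) (by omega), Finset.mul_sum]
        · refine Finset.sum_bij' (fun σ _ => σ * Equiv.swap j K) (fun σ _ => σ * Equiv.swap j K)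
            ?_ ?_ ?_ ?_ ?_
          · intro σ hσ
            simp only [Finset.mem_filter, Finset.mem_univ, true_and] at hσ ⊢
            exact (good_close K O hO' j hj σ).1 ⟨hσ.1.1, hσ.2⟩
          · intro σ hσ
            simp only [Finset.mem_filter, Finset.mem_univ, true_and] at hσ ⊢
            have := (good_close K O hO' j hj (σ * Equiv.swap j K)).2 (by simpa [mul_assoc] using hσ)
            refine ⟨⟨this.1, ?_⟩, this.2⟩
            rw [this.2]; simpa using hj
          · intro σ _; simp [mul_assoc]
          · intro σ _; simp [mul_assoc]
          · intro σ hσ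
            simp only [Finset.mem_filter, Finset.mem_univ, true_and] at hσ
            rw [cro_close K O hO' j hj σ hσ.1.1 hσ.2, pow_add]
        · intro i hi
          have := hO i (Finset.mem_of_mem_erase hi); omega
      · intro σ hσ
        simp only [Finset.mem_filter, Finset.mem_univ, true_and, not_not] at hσ
        exact hσ.2

open Polynomial in
/-- The crossing generating function of matchings equals the weighted count of
Dyck paths where a down step starting at height `h` has weight `[h]_q`. -/
theorem stmt4 (n : ℕ) :
    ∑ σ ∈ Finset.univ.filter (fun σ : Equiv.Perm (Fin (2*n)) => IsMatching σ),
        (X : Polynomial ℤ) ^ cro σ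
    = ∑ P ∈ Finset.univ.filter
        (fun P : Fin (2*n) → Step => IsMotzkin P ∧ ∀ i, P i ≠ Step.L),
        ∏ i : Fin (2*n),
          (if P i = Step.D then geo (X : Polynomial ℤ) (hsum P (i : ℕ)) else 1) := by
  have h1 := path_side (2*n) 0
  have h2 := match_side (N := 2*n) (2*n) 0 (by omega) ∅ (by simp)
  simp only [Nat.cast_zero, zero_add] at h1
  rw [Finset.card_empty] at h2
  rw [h1, ← h2]
  refine Finset.sum_congr ?_ fun _ _ => rfl
  ext σ
  simp [Good, IsMatching]
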